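/- For integers n, r ≥ 1 and 1 ≤ k ≤ n, define U_r^{(n)}(k) = n^{-r}·Σ_{j|k} μ(j)·⌊n/j⌋^r and W_r^{(n)}(k) = n^{-r}·Σ_{j|k} φ(j)·⌊n/j⌋^r. Then: (a) |U_r^{(n)}(k) − φ_r(k)/k^r| ≤ r·τ(k)/n, where φ_r is Jordan's totient; and (b) 0 ≤ P_r(k)/k^r − W_r^{(n)}(k), with P_r(k)/k^r − W_r^{(n)}(k) ≤ k/n when r = 1 and P_r(k)/k^r − W_r^{(n)}(k) ≤ r·τ(k)/n when r ≥ 2, where P_r(k) = Σ_{i=1}^k gcd(i,k)^r (so that P_r(k)/k^r = Σ_{d|k} φ(d)/d^r). -/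

import Mathlib

/-- Jordan's totient function `φ_r(k) = k^r Π_{p|k} (1 − 1/p^r)`, as a real number. -/
noncomputable def jordanTotient (r k : ℕ) : ℝ :=
  (k : ℝ) ^ r * ∏ p ∈ k.primeFactors, (1 - 1 / (p : ℝ) ^ r)

/-- The generalized Pillai function `P_r(k) = Σ_{i=1}^k gcd(i,k)^r`. -/
def pillaiPow (r k : ℕ) : ℕ := ∑ i ∈ Finset.Icc 1 k, Nat.gcd i k ^ r

/-- The marginal probability `U_r^{(n)}(k) = n^{-r} Σ_{j∣k} μ(j) ⌊n/j⌋^r`. -/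
noncomputable def margU (r n k : ℕ) : ℝ :=
  ((n : ℝ) ^ r)⁻¹ * ∑ j ∈ k.divisors, ((ArithmeticFunction.moebius j : ℤ) : ℝ) * ((n / j : ℕ) : ℝ) ^ r

/-- The marginal expectation `W_r^{(n)}(k) = n^{-r} Σ_{j∣k} φ(j) ⌊n/j⌋^r`. -/
noncomputable def margW (r n k : ℕ) : ℝ :=
  ((n : ℝ) ^ r)⁻¹ * ∑ j ∈ k.divisors, (Nat.totient j : ℝ) * ((n / j : ℕ) : ℝ) ^ r

open UniqueFactorizationMonoid in
/-- Euler product expansion of a multiplicative function twisted by the Möbius function. -/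
theorem ArithmeticFunction.IsMultiplicative.prod_primeFactors_one_sub {R : Type*} [CommRing R]
    {f : ArithmeticFunction R} (hf : f.IsMultiplicative) {k : ℕ} (hk : k ≠ 0) :
    ∏ p ∈ k.primeFactors, (1 - f p) = ∑ d ∈ k.divisors, ((moebius d : ℤ) : R) * f d := by
  rw [← Nat.primeFactors_radical, hf.prodPrimeFactors_one_sub_of_squarefree f squarefree_radical]
  refine Finset.sum_subset (Nat.divisors_subset_of_dvd hk radical_dvd_self) fun d hd hd' => ?_
  have hsq : ¬ Squarefree d := fun h => hd' <| Nat.mem_divisors.2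
    ⟨(dvd_radical_iff h.isRadical hk).2 (Nat.dvd_of_mem_divisors hd), radical_ne_zero⟩
  simp [moebius_eq_zero_of_not_squarefree hsq]

theorem jordanTotient_div_pow {r k : ℕ} (hr : r ≠ 0) (hk : k ≠ 0) :
    jordanTotient r k / (k : ℝ) ^ r =
      ∑ d ∈ k.divisors, ((ArithmeticFunction.moebius d : ℤ) : ℝ) * (1 / (d : ℝ)) ^ r := by
  let f : ArithmeticFunction ℝ := ⟨fun d => (1 / (d : ℝ)) ^ r, by simp [hr]⟩
  have hf : f.IsMultiplicative := by
    refine ⟨by simp [f], fun {m n} _ => ?_⟩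
    change (1 / ((m * n : ℕ) : ℝ)) ^ r = (1 / (m : ℝ)) ^ r * (1 / (n : ℝ)) ^ r
    rw [Nat.cast_mul, ← mul_pow, one_div_mul_one_div]
  have hprod := hf.prod_primeFactors_one_sub hk
  have hk' : (k : ℝ) ^ r ≠ 0 := pow_ne_zero _ (Nat.cast_ne_zero.2 hk)
  rw [jordanTotient, mul_div_cancel_left₀ _ hk']
  simpa [f] using hprod

theorem pillaiPow_eq_sum_divisors (r k : ℕ) :
    pillaiPow r k = ∑ d ∈ k.divisors, Nat.totient (k / d) * d ^ r := by
  rcases eq_or_ne k 0 with rfl | hk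
  · simp [pillaiPow]
  have hshift : pillaiPow r k = ∑ i ∈ Finset.range k, Nat.gcd k i ^ r := by
    obtain ⟨m, rfl⟩ := Nat.exists_eq_succ_of_ne_zero hk
    rw [pillaiPow, ← Finset.Ico_add_one_right_eq_Icc, Finset.sum_Ico_eq_sum_range,
      Nat.add_sub_cancel, Finset.sum_range_succ, Finset.sum_range_succ']
    simp [Nat.gcd_comm, Nat.add_comm]
  rw [hshift, ← Finset.sum_fiberwise_of_maps_to (t := k.divisors) (g := fun i => Nat.gcd k i)
    fun i _ => Nat.mem_divisors.2 ⟨Nat.gcd_dvd_left k i, hk⟩]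
  refine Finset.sum_congr rfl fun d hd => ?_
  rw [Nat.totient_div_of_dvd (Nat.dvd_of_mem_divisors hd), ← smul_eq_mul, ← Finset.sum_const]
  exact Finset.sum_congr rfl fun i hi => by rw [(Finset.mem_filter.1 hi).2]

theorem pillaiPow_div_pow (r k : ℕ) :
    (pillaiPow r k : ℝ) / (k : ℝ) ^ r =
      ∑ d ∈ k.divisors, (Nat.totient d : ℝ) * (1 / (d : ℝ)) ^ r := by
  rw [pillaiPow_eq_sum_divisors, Nat.cast_sum, Finset.sum_div,
    ← Nat.sum_div_divisors k fun d => (Nat.totient d : ℝ) * (1 / (d : ℝ)) ^ r]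
  refine Finset.sum_congr rfl fun d hd => ?_
  have hd0 : (d : ℝ) ≠ 0 := Nat.cast_ne_zero.2 (Nat.pos_of_mem_divisors hd).ne'
  rw [Nat.cast_div (Nat.dvd_of_mem_divisors hd) hd0, one_div_div, div_pow]
  push_cast
  ring

theorem floor_div_self_le {n : ℕ} (hn : n ≠ 0) (j : ℕ) :
    ((n / j : ℕ) : ℝ) / n ≤ 1 / (j : ℝ) := by
  have hn' : (0 : ℝ) < n := by positivity
  calc ((n / j : ℕ) : ℝ) / n ≤ (n / j : ℝ) / n := by gcongr; exact Nat.cast_div_le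
    _ = 1 / (j : ℝ) := by field_simp

theorem pow_floor_div_self_le (r : ℕ) {n : ℕ} (hn : n ≠ 0) (j : ℕ) :
    (((n / j : ℕ) : ℝ) / n) ^ r ≤ (1 / (j : ℝ)) ^ r :=
  pow_le_pow_left₀ (by positivity) (floor_div_self_le hn j) r

theorem one_div_pow_sub_pow_floor_div_self_le (r : ℕ) {n j : ℕ} (hn : n ≠ 0) (hj : j ≠ 0) :
    (1 / (j : ℝ)) ^ r - (((n / j : ℕ) : ℝ) / n) ^ r ≤ r * (1 / (j : ℝ)) ^ (r - 1) / n := by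
  have hn' : (0 : ℝ) < n := by positivity
  have hj' : (0 : ℝ) < j := by positivity
  have hle := floor_div_self_le hn j
  have hgap : 1 / (j : ℝ) - ((n / j : ℕ) : ℝ) / n ≤ 1 / n := by
    have hlt : (n : ℝ) < j * ((n / j : ℕ) + 1) := by
      exact_mod_cast Nat.lt_mul_div_succ n (Nat.pos_of_ne_zero hj)
    rw [sub_le_iff_le_add, ← add_div, div_le_div_iff₀ hj' hn']
    linarith
  have hpow := abs_pow_sub_pow_le (1 / (j : ℝ)) (((n / j : ℕ) : ℝ) / n) r
  rw [abs_of_nonneg (sub_nonneg.2 hle), abs_of_nonneg (by positivity : 0 ≤ 1 / (j : ℝ)),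
    abs_of_nonneg (by positivity : 0 ≤ ((n / j : ℕ) : ℝ) / n), max_eq_left hle] at hpow
  calc (1 / (j : ℝ)) ^ r - (((n / j : ℕ) : ℝ) / n) ^ r
      ≤ (1 / (j : ℝ) - ((n / j : ℕ) : ℝ) / n) * r * (1 / (j : ℝ)) ^ (r - 1) :=
        (le_abs_self _).trans hpow
    _ ≤ 1 / n * r * (1 / (j : ℝ)) ^ (r - 1) := by gcongr
    _ = r * (1 / (j : ℝ)) ^ (r - 1) / n := by ring

theorem inv_pow_mul_sum_floor (r n : ℕ) (s : Finset ℕ) (g : ℕ → ℝ) :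
    ((n : ℝ) ^ r)⁻¹ * ∑ j ∈ s, g j * ((n / j : ℕ) : ℝ) ^ r =
      ∑ j ∈ s, g j * (((n / j : ℕ) : ℝ) / n) ^ r := by
  rw [Finset.mul_sum]
  exact Finset.sum_congr rfl fun j _ => by rw [div_pow]; ring

theorem abs_margU_sub_le {n r k : ℕ} (hn : n ≠ 0) (hr : r ≠ 0) (hk : k ≠ 0) :
    |margU r n k - jordanTotient r k / (k : ℝ) ^ r| ≤ r * (k.divisors.card : ℝ) / n := by
  rw [margU, inv_pow_mul_sum_floor, jordanTotient_div_pow hr hk, ← Finset.sum_sub_distrib]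
  have hterm : ∀ j ∈ k.divisors,
      |((ArithmeticFunction.moebius j : ℤ) : ℝ) * (((n / j : ℕ) : ℝ) / n) ^ r -
        ((ArithmeticFunction.moebius j : ℤ) : ℝ) * (1 / (j : ℝ)) ^ r| ≤ (r : ℝ) / n := by
    intro j hj
    have hj0 : j ≠ 0 := (Nat.pos_of_mem_divisors hj).ne'
    have hj1 : (1 : ℝ) ≤ j := by exact_mod_cast Nat.pos_of_ne_zero hj0
    have hmu : |((ArithmeticFunction.moebius j : ℤ) : ℝ)| ≤ 1 := by
      exact_mod_cast ArithmeticFunction.abs_moebius_le_one (n := j)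
    have hle1 : (1 / (j : ℝ)) ^ (r - 1) ≤ 1 :=
      pow_le_one₀ (by positivity) ((div_le_one (by positivity)).2 hj1)
    rw [← mul_sub, abs_mul, abs_sub_comm,
      abs_of_nonneg (sub_nonneg.2 (pow_floor_div_self_le r hn j))]
    calc _ ≤ 1 * (r * (1 / (j : ℝ)) ^ (r - 1) / n) :=
          mul_le_mul hmu (one_div_pow_sub_pow_floor_div_self_le r hn hj0)
            (sub_nonneg.2 (pow_floor_div_self_le r hn j)) zero_le_one
      _ ≤ 1 * (r * 1 / n) := by gcongr
      _ = (r : ℝ) / n := by ring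
  calc _ ≤ _ := Finset.abs_sum_le_sum_abs _ _
    _ ≤ ∑ _j ∈ k.divisors, (r : ℝ) / n := Finset.sum_le_sum hterm
    _ = r * (k.divisors.card : ℝ) / n := by rw [Finset.sum_const, nsmul_eq_mul]; ring

theorem pillaiPow_div_sub_margW (r n k : ℕ) :
    (pillaiPow r k : ℝ) / (k : ℝ) ^ r - margW r n k =
      ∑ j ∈ k.divisors,
        (Nat.totient j : ℝ) * ((1 / (j : ℝ)) ^ r - (((n / j : ℕ) : ℝ) / n) ^ r) := by
  rw [margW, inv_pow_mul_sum_floor, pillaiPow_div_pow, ← Finset.sum_sub_distrib]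
  simp only [mul_sub]

theorem pillaiPow_div_sub_margW_le_sum (r k : ℕ) {n : ℕ} (hn : n ≠ 0) :
    (pillaiPow r k : ℝ) / (k : ℝ) ^ r - margW r n k ≤
      ∑ j ∈ k.divisors, (Nat.totient j : ℝ) * (r * (1 / (j : ℝ)) ^ (r - 1) / n) := by
  rw [pillaiPow_div_sub_margW]
  refine Finset.sum_le_sum fun j hj => ?_
  gcongr
  exact one_div_pow_sub_pow_floor_div_self_le r hn (Nat.pos_of_mem_divisors hj).ne'

/-- **Estimates for marginal probabilities and expectations.** For `1 ≤ k ≤ n` and `r ≥ 1`: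
(a) `|U_r^{(n)}(k) − φ_r(k)/k^r| ≤ r τ(k)/n`; and (b) `0 ≤ P_r(k)/k^r − W_r^{(n)}(k)`, with
`P_r(k)/k^r − W_r^{(n)}(k) ≤ k/n` when `r = 1` and `≤ r τ(k)/n` when `r ≥ 2`. -/
theorem marginal_estimates (n r k : ℕ) (hn : 1 ≤ n) (hr : 1 ≤ r) (hk : 1 ≤ k) (hkn : k ≤ n) :
    |margU r n k - jordanTotient r k / (k : ℝ) ^ r| ≤ r * (k.divisors.card : ℝ) / n ∧
    0 ≤ (pillaiPow r k : ℝ) / (k : ℝ) ^ r - margW r n k ∧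
    (r = 1 → (pillaiPow r k : ℝ) / (k : ℝ) ^ r - margW r n k ≤ (k : ℝ) / n) ∧
    (2 ≤ r → (pillaiPow r k : ℝ) / (k : ℝ) ^ r - margW r n k ≤
      r * (k.divisors.card : ℝ) / n) := by
  have hn0 : n ≠ 0 := by omega
  have hk0 : k ≠ 0 := by omega
  refine ⟨abs_margU_sub_le hn0 (by omega) hk0, ?_, ?_, fun hr2 => ?_⟩
  · rw [pillaiPow_div_sub_margW]
    exact Finset.sum_nonneg fun j _ =>
      mul_nonneg (Nat.cast_nonneg _) (sub_nonneg.2 (pow_floor_div_self_le r hn0 j))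
  · rintro rfl
    refine (pillaiPow_div_sub_margW_le_sum 1 k hn0).trans_eq ?_
    have htot : ∑ j ∈ k.divisors, (Nat.totient j : ℝ) = k := by exact_mod_cast Nat.sum_totient k
    simp only [Nat.cast_one, Nat.sub_self, pow_zero, mul_one]
    rw [← Finset.sum_mul, htot, mul_one_div]
  · refine (pillaiPow_div_sub_margW_le_sum r k hn0).trans ?_
    calc _ ≤ ∑ _j ∈ k.divisors, (r : ℝ) / n := Finset.sum_le_sum fun j hj => ?_
      _ = r * (k.divisors.card : ℝ) / n := by rw [Finset.sum_const, nsmul_eq_mul]; ring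
    have hj0 : 0 < j := Nat.pos_of_mem_divisors hj
    have hj1 : (1 : ℝ) ≤ j := by exact_mod_cast hj0
    have hpow : (1 / (j : ℝ)) ^ (r - 1) ≤ 1 / (j : ℝ) :=
      pow_le_of_le_one (by positivity) ((div_le_one (by positivity)).2 hj1) (by omega)
    have htot : (Nat.totient j : ℝ) ≤ j := by exact_mod_cast Nat.totient_le j
    calc (Nat.totient j : ℝ) * (r * (1 / (j : ℝ)) ^ (r - 1) / n)
        ≤ j * (r * (1 / (j : ℝ)) / n) := by gcongr
      _ = (r : ℝ) / n := by field_simp
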